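/- Let p, m, n ∈ ℕ with m ≤ p ≤ m+n, let a, b ∈ ℝ with a, b > 0, and let α ∈ ℝ with α > −1. Then ∫_{0}^{∞} L_p^α(x)·L_m^α(ax)·L_n^α(bx)·x^α e^{−x} dx = [Γ(α+1+n)·(−α−p)_m / (m!·(p−m)!·(n+m−p)!)] · (−a/b)^m · b^p · Σ_{k=0}^{∞} Σ_{l=0}^{∞} [(p−n−m)_{k+l}·(−m)_k·(−α−m)_k·(p+1)_l·(α+1+p)_l] / [(p−m+1)_{k+l}·(α+p−m+1)_{k+l}·k!·l!] · (−b/a)^k · b^l, i.e., the integral equals this prefactor times the terminating Kampé de Fériet double hypergeometric series F^{1:2;2}_{2:0;0}(p−n−m : −m, −α−m ; p+1, α+p+1 | p−m+1, α+p−m+1 : — ; — | −b/a, b); the double sum is finite (all terms with k > m or k+l > n+m−p vanish). -/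

import Mathlib

open MeasureTheory

/-- Pochhammer symbol `(a)_j` for real `a` and natural `j`. -/
noncomputable def poch (a : ℝ) (j : ℕ) : ℝ := (ascPochhammer ℝ j).eval a

/-- Pochhammer symbol `(a)_j` for integer index, with the convention
`(a)_{-j} = 1/((a-1)(a-2)⋯(a-j))` for `j ≥ 1`. -/
noncomputable def pochZ (a : ℝ) (j : ℤ) : ℝ :=
  if 0 ≤ j then poch a j.toNat
  else (∏ i ∈ Finset.range (-j).toNat, (a - (i + 1)))⁻¹

/-- Factorial of an integer: `j!` for `j ≥ 0` and `0` for `j < 0`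
(encoding `1/(negative integer)! = 0` via Lean's division by zero). -/
noncomputable def ifact (j : ℤ) : ℝ := if 0 ≤ j then (j.toNat.factorial : ℝ) else 0

/-- Generalized hypergeometric sum `ᵣF_s(a; b; z)` (intended for terminating series,
where all terms beyond the termination index vanish). -/
noncomputable def hypSum (a b : List ℝ) (z : ℝ) : ℝ :=
  ∑' j : ℕ, ((a.map fun t => poch t j).prod /
    ((b.map fun t => poch t j).prod * (j.factorial : ℝ))) * z ^ j

/-- Laguerre polynomial `L_n^α(x)`. -/
noncomputable def lagL (α : ℝ) (n : ℕ) (x : ℝ) : ℝ :=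
  ∑ k ∈ Finset.range (n + 1),
    (-1) ^ k * poch (α + k + 1) (n - k) / (((n - k).factorial : ℝ) * k.factorial) * x ^ k

theorem poch_zero (a : ℝ) : poch a 0 = 1 := by simp [poch]

theorem poch_succ (a : ℝ) (j : ℕ) : poch a (j + 1) = poch a j * (a + j) := by
  simp [poch, ascPochhammer_succ_eval]

theorem poch_succ_left (a : ℝ) (j : ℕ) : poch a (j + 1) = a * poch (a + 1) j := by
  simp [poch, ascPochhammer_succ_left, Polynomial.eval_comp]

theorem poch_pos {a : ℝ} (ha : 0 < a) (j : ℕ) : 0 < poch a j :=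
  ascPochhammer_pos j a ha

theorem Gamma_add_nat {s : ℝ} (hs : 0 < s) (j : ℕ) :
    Real.Gamma (s + j) = Real.Gamma s * poch s j := by
  induction j with
  | zero => simp [poch_zero]
  | succ j ih =>
    rw [poch_succ, Nat.cast_succ, ← add_assoc, Real.Gamma_add_one (by positivity), ih]
    ring

theorem poch_neg (x : ℝ) (k : ℕ) : poch (-x) k = (-1) ^ k * poch (x - k + 1) k := by
  induction k with
  | zero => simp [poch_zero]
  | succ k ih =>
    rw [poch_succ, poch_succ_left, ih]
    push_cast
    rw [show x - (k + 1 : ℝ) + 1 + 1 = x - k + 1 by ring]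
    ring

theorem poch_natCast_add_one (N k : ℕ) :
    poch ((N : ℝ) + 1) k = (N + k).factorial / N.factorial := by
  rw [eq_div_iff (by positivity)]
  induction k with
  | zero => simp [poch_zero]
  | succ k ih =>
    rw [poch_succ, ← add_assoc, Nat.factorial_succ, Nat.cast_mul, ← ih]
    push_cast
    ring

theorem poch_neg_natCast {N k : ℕ} (h : k ≤ N) :
    poch (-(N : ℝ)) k = (-1) ^ k * (N.factorial / (N - k).factorial) := by
  rw [poch_neg, ← Nat.cast_sub h, poch_natCast_add_one, Nat.sub_add_cancel h]

theorem poch_neg_natCast_of_lt {N k : ℕ} (h : N < k) : poch (-(N : ℝ)) k = 0 :=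
  (ascPochhammer_eval_eq_zero_iff k _).2 ⟨N, h, by simp⟩

theorem poch_add_one_sub (y : ℝ) (r : ℕ) :
    poch (y + 1) r - poch y r = r * poch (y + 1) (r - 1) := by
  cases r with
  | zero => simp [poch_zero]
  | succ r =>
    rw [poch_succ, poch_succ_left y, Nat.add_sub_cancel]
    push_cast
    ring

theorem fwdDiff_iter_poch (j n : ℕ) (x : ℝ) :
    (fwdDiff (1 : ℝ))^[n] (fun y => poch y j) x = j.descFactorial n * poch (x + n) (j - n) := by
  induction n generalizing x with
  | zero => simp
  | succ n ih =>
    rw [Function.iterate_succ_apply', fwdDiff, ih, ih, ← mul_sub,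
      show x + 1 + (n : ℝ) = x + n + 1 by ring, poch_add_one_sub, Nat.descFactorial_succ,
      Nat.sub_sub]
    push_cast
    rw [← add_assoc]
    ring

theorem sum_choose_mul_poch (j n : ℕ) (x : ℝ) :
    ∑ k ∈ Finset.range (n + 1), (-1) ^ k * (n.choose k : ℝ) * poch (x + k) j =
      (-1) ^ n * (j.descFactorial n * poch (x + n) (j - n)) := by
  rw [← fwdDiff_iter_poch, fwdDiff_iter_eq_sum_shift, Finset.mul_sum]
  refine Finset.sum_congr rfl fun k hk => ?_
  have hk : k ≤ n := Nat.lt_succ_iff.1 (Finset.mem_range.1 hk)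
  have h : (-1 : ℝ) ^ n * (-1) ^ (n - k) = (-1) ^ k := by
    obtain ⟨d, rfl⟩ := Nat.exists_eq_add_of_le hk
    rw [Nat.add_sub_cancel_left, pow_add, mul_assoc, ← mul_pow]
    simp
  rw [← h]
  simp
  ring

/-- The coefficient of `x ^ k` in the Laguerre polynomial `L_n^α`. -/
noncomputable def lagCoeff (α : ℝ) (n k : ℕ) : ℝ :=
  (-1) ^ k * poch (α + k + 1) (n - k) / (((n - k).factorial : ℝ) * k.factorial)

theorem lagL_eq_sum (α : ℝ) (n : ℕ) (x : ℝ) :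
    lagL α n x = ∑ k ∈ Finset.range (n + 1), lagCoeff α n k * x ^ k := rfl

theorem sum_lagCoeff_mul_Gamma {α : ℝ} (hα : -1 < α) (n j : ℕ) :
    ∑ k ∈ Finset.range (n + 1), lagCoeff α n k * Real.Gamma (α + 1 + (k + j : ℕ)) =
      (-1) ^ n * j.choose n * Real.Gamma (α + 1 + j) := by
  have h0 : 0 < α + 1 := by linarith
  have hterm : ∀ k ∈ Finset.range (n + 1),
      lagCoeff α n k * Real.Gamma (α + 1 + (k + j : ℕ)) =
        Real.Gamma (α + 1 + n) / n.factorial *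
          ((-1) ^ k * (n.choose k : ℝ) * poch (α + 1 + k) j) := by
    intro k hk
    have hk : k ≤ n := Nat.lt_succ_iff.1 (Finset.mem_range.1 hk)
    have hpos : 0 < α + 1 + k := by positivity
    have h1 := Gamma_add_nat hpos j
    have h2 := Gamma_add_nat hpos (n - k)
    rw [Nat.cast_sub hk, show α + 1 + (k : ℝ) + (n - k) = α + 1 + n by ring] at h2
    rw [lagCoeff, Nat.cast_add, ← add_assoc, h1, h2, Nat.cast_choose ℝ hk,
      show α + (k : ℝ) + 1 = α + 1 + k by ring]
    field_simp
  rw [Finset.sum_congr rfl hterm, ← Finset.mul_sum, sum_choose_mul_poch]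
  rcases lt_or_ge j n with h | h
  · simp [Nat.descFactorial_of_lt h, Nat.choose_eq_zero_of_lt h]
  · have h1 := Gamma_add_nat (s := α + 1 + n) (by positivity) (j - n)
    rw [Nat.cast_sub h, show α + 1 + (n : ℝ) + (j - n) = α + 1 + j by ring] at h1
    rw [h1, Nat.descFactorial_eq_factorial_mul_choose, Nat.cast_mul]
    field_simp

theorem pow_mul_rpow_mul_exp_neg_eqOn (α : ℝ) (N : ℕ) :
    Set.EqOn (fun x : ℝ => Real.exp (-x) * x ^ (α + 1 + N - 1))
      (fun x => x ^ N * x ^ α * Real.exp (-x)) (Set.Ioi 0) := by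
  intro x hx
  have hx : 0 < x := hx
  simp only
  rw [show α + 1 + (N : ℝ) - 1 = N + α by ring, Real.rpow_add hx, Real.rpow_natCast]
  ring

theorem integrableOn_pow_mul_rpow_mul_exp_neg {α : ℝ} (hα : -1 < α) (N : ℕ) :
    IntegrableOn (fun x : ℝ => x ^ N * x ^ α * Real.exp (-x)) (Set.Ioi 0) := by
  have h0 : 0 < α + 1 := by linarith
  exact (Real.GammaIntegral_convergent (s := α + 1 + N) (by positivity)).congr_fun
    (pow_mul_rpow_mul_exp_neg_eqOn α N) measurableSet_Ioi

theorem integral_pow_mul_rpow_mul_exp_neg {α : ℝ} (hα : -1 < α) (N : ℕ) :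
    ∫ x in Set.Ioi (0 : ℝ), x ^ N * x ^ α * Real.exp (-x) = Real.Gamma (α + 1 + N) := by
  have h0 : 0 < α + 1 := by linarith
  rw [Real.Gamma_eq_integral (by positivity)]
  exact (setIntegral_congr_fun measurableSet_Ioi (pow_mul_rpow_mul_exp_neg_eqOn α N)).symm

theorem lagL_mul_pow_eq_sum (α : ℝ) (p N : ℕ) :
    (fun x : ℝ => lagL α p x * x ^ N * x ^ α * Real.exp (-x)) = fun x =>
      ∑ k ∈ Finset.range (p + 1), lagCoeff α p k * (x ^ (k + N) * x ^ α * Real.exp (-x)) := by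
  funext x
  simp only [lagL_eq_sum, Finset.sum_mul]
  refine Finset.sum_congr rfl fun k _ => ?_
  ring

theorem integrableOn_lagL_mul_pow {α : ℝ} (hα : -1 < α) (p N : ℕ) :
    IntegrableOn (fun x : ℝ => lagL α p x * x ^ N * x ^ α * Real.exp (-x)) (Set.Ioi 0) := by
  rw [lagL_mul_pow_eq_sum]
  exact integrable_finsetSum _ fun k _ =>
    (integrableOn_pow_mul_rpow_mul_exp_neg hα (k + N)).const_mul _

theorem integral_lagL_mul_pow {α : ℝ} (hα : -1 < α) (p N : ℕ) :
    ∫ x in Set.Ioi (0 : ℝ), lagL α p x * x ^ N * x ^ α * Real.exp (-x) =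
      (-1) ^ p * N.choose p * Real.Gamma (α + 1 + N) := by
  rw [lagL_mul_pow_eq_sum, integral_finsetSum _ fun k _ =>
    (integrableOn_pow_mul_rpow_mul_exp_neg hα (k + N)).const_mul _]
  simp only [integral_const_mul, integral_pow_mul_rpow_mul_exp_neg hα, sum_lagCoeff_mul_Gamma hα]

theorem integral_lagL_mul_lagL_mul_lagL {α : ℝ} (hα : -1 < α) (p m n : ℕ) (a b : ℝ) :
    ∫ x in Set.Ioi (0 : ℝ),
        lagL α p x * lagL α m (a * x) * lagL α n (b * x) * x ^ α * Real.exp (-x) =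
      ∑ q ∈ Finset.range (m + 1) ×ˢ Finset.range (n + 1),
        lagCoeff α m q.1 * a ^ q.1 * (lagCoeff α n q.2 * b ^ q.2) *
          ((-1) ^ p * (q.1 + q.2).choose p * Real.Gamma (α + 1 + (q.1 + q.2 : ℕ))) := by
  have h : (fun x : ℝ =>
      lagL α p x * lagL α m (a * x) * lagL α n (b * x) * x ^ α * Real.exp (-x)) = fun x =>
      ∑ q ∈ Finset.range (m + 1) ×ˢ Finset.range (n + 1),
        lagCoeff α m q.1 * a ^ q.1 * (lagCoeff α n q.2 * b ^ q.2) *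
          (lagL α p x * x ^ (q.1 + q.2) * x ^ α * Real.exp (-x)) := by
    funext x
    rw [lagL_eq_sum α m, lagL_eq_sum α n, mul_assoc (lagL α p x), Finset.sum_mul_sum,
      ← Finset.sum_product', Finset.mul_sum, Finset.sum_mul, Finset.sum_mul]
    refine Finset.sum_congr rfl fun q _ => ?_
    ring
  rw [h, integral_finsetSum _ fun q _ => (integrableOn_lagL_mul_pow hα p (q.1 + q.2)).const_mul _]
  simp only [integral_const_mul, integral_lagL_mul_pow hα]

/-- With `m = i + k` and `p = i + k + d`, the index pair `(i, d + k + l)` of the expanded integral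
corresponds to the index pair `(k, l)` of the Kampé de Fériet series. -/
theorem lagCoeff_term_eq {α : ℝ} (hα : -1 < α) {a b : ℝ} (ha : 0 < a) (hb : 0 < b)
    (i d k l r : ℕ) :
    lagCoeff α (i + k) i * a ^ i * (lagCoeff α (d + k + l + r) (d + k + l) * b ^ (d + k + l)) *
        ((-1) ^ (i + k + d) * (i + k + d + l).choose (i + k + d) *
          Real.Gamma (α + 1 + (i + k + d + l : ℕ))) =
      Real.Gamma (α + 1 + (d + k + l + r : ℕ)) * poch (-α - ((i + k + d : ℕ) : ℝ)) (i + k) /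
          (((i + k).factorial : ℝ) * d.factorial * (k + l + r).factorial) *
        (-(a / b)) ^ (i + k) * b ^ (i + k + d) *
        (poch (-((k + l + r : ℕ) : ℝ)) (k + l) * poch (-((i + k : ℕ) : ℝ)) k *
              poch (-α - ((i + k : ℕ) : ℝ)) k * poch (((i + k + d : ℕ) : ℝ) + 1) l *
              poch (α + 1 + (i + k + d : ℕ)) l /
            (poch ((d : ℝ) + 1) (k + l) * poch (α + d + 1) (k + l) *
              (k.factorial : ℝ) * (l.factorial : ℝ)) *
          (-(b / a)) ^ k * b ^ l) := by
  have h0 : 0 < α + 1 := by linarith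
  have hd : 0 < α + d + 1 := by linarith [(Nat.cast_nonneg d : (0 : ℝ) ≤ d)]
  have hG : Real.Gamma (α + d + 1) ≠ 0 := (Real.Gamma_pos_of_pos hd).ne'
  have hP := (poch_pos hd (k + l)).ne'
  have e1 : Real.Gamma (α + 1 + (i + k + d + l : ℕ)) =
      Real.Gamma (α + d + 1) * poch (α + d + 1) (i + k) * poch (α + 1 + (i + k + d : ℕ)) l := by
    rw [← Gamma_add_nat hd, show α + d + 1 + ((i + k : ℕ) : ℝ) = α + 1 + (i + k + d : ℕ) by
      push_cast; ring, ← Gamma_add_nat (by positivity)]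
    push_cast
    congr 1
    ring
  have e2 : Real.Gamma (α + 1 + (d + k + l + r : ℕ)) =
      Real.Gamma (α + d + 1) * poch (α + d + 1) (k + l) * poch (α + (d + k + l : ℕ) + 1) r := by
    rw [← Gamma_add_nat hd, show α + d + 1 + ((k + l : ℕ) : ℝ) = α + (d + k + l : ℕ) + 1 by
      push_cast; ring, ← Gamma_add_nat (by push_cast; linarith [(Nat.cast_nonneg k : (0 : ℝ) ≤ k),
        (Nat.cast_nonneg l : (0 : ℝ) ≤ l)])]
    push_cast
    congr 1
    ring
  have e3 : poch (-α - ((i + k + d : ℕ) : ℝ)) (i + k) =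
      (-1) ^ (i + k) * poch (α + d + 1) (i + k) := by
    rw [show -α - ((i + k + d : ℕ) : ℝ) = -(α + (i + k + d : ℕ)) by ring, poch_neg]
    congr 2
    push_cast
    ring
  have e4 : poch (-α - ((i + k : ℕ) : ℝ)) k = (-1) ^ k * poch (α + i + 1) k := by
    rw [show -α - ((i + k : ℕ) : ℝ) = -(α + (i + k : ℕ)) by ring, poch_neg]
    congr 2
    push_cast
    ring
  rw [e1, e2, e3, e4, poch_neg_natCast (by omega : k + l ≤ k + l + r),
    poch_neg_natCast (by omega : k ≤ i + k), poch_natCast_add_one, poch_natCast_add_one,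
    Nat.cast_add_choose, lagCoeff, lagCoeff]
  rw [show d + k + l = d + (k + l) by ring]
  simp only [Nat.add_sub_cancel_left, Nat.add_sub_cancel, neg_pow (a / b), neg_pow (b / a), div_pow]
  simp only [pow_add]
  rcases neg_one_pow_eq_or ℝ i with hi | hi <;> rcases neg_one_pow_eq_or ℝ k with hk | hk <;>
    rcases neg_one_pow_eq_or ℝ d with hd' | hd' <;> rcases neg_one_pow_eq_or ℝ l with hl | hl <;>
    simp only [hi, hk, hd', hl] <;> field_simp

theorem stmt18 (p m n : ℕ) (hmp : m ≤ p) (hp : p ≤ m + n) (a b : ℝ) (ha : 0 < a)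
    (hb : 0 < b) (α : ℝ) (hα : -1 < α) :
    (∫ x in Set.Ioi (0 : ℝ),
        lagL α p x * lagL α m (a * x) * lagL α n (b * x) * x ^ α * Real.exp (-x)) =
      Real.Gamma (α + 1 + n) * poch (-α - (p : ℝ)) m /
          ((m.factorial : ℝ) * (p - m).factorial * (n + m - p).factorial) *
        (-(a / b)) ^ m * b ^ p *
        ∑' q : ℕ × ℕ,
          poch ((p : ℝ) - n - m) (q.1 + q.2) * poch (-(m : ℝ)) q.1 *
              poch (-α - (m : ℝ)) q.1 * poch ((p : ℝ) + 1) q.2 * poch (α + 1 + p) q.2 /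
            (poch ((p : ℝ) - m + 1) (q.1 + q.2) * poch (α + (p : ℝ) - m + 1) (q.1 + q.2) *
              (q.1.factorial : ℝ) * (q.2.factorial : ℝ)) *
          (-(b / a)) ^ q.1 * b ^ q.2 := by
  obtain ⟨d, rfl⟩ := Nat.exists_eq_add_of_le hmp
  obtain ⟨N, rfl⟩ : ∃ N, n = d + N := ⟨n - d, by omega⟩
  have hN : d + N + m - (m + d) = N := by omega
  have hd : m + d - m = d := by omega
  rw [integral_lagL_mul_lagL_mul_lagL hα,
    tsum_eq_sum (s := (Finset.range (m + 1) ×ˢ Finset.range (N + 1)).filter fun q => q.1 + q.2 ≤ N),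
    Finset.mul_sum, hN, hd]
  · rw [← Finset.sum_filter_of_ne (p := fun q : ℕ × ℕ => m + d ≤ q.1 + q.2)]
    · refine Finset.sum_bij' (fun q _ => (m - q.1, q.1 + q.2 - (m + d)))
        (fun q _ => (m - q.1, d + q.1 + q.2)) ?_ ?_ ?_ ?_ ?_
      · rintro ⟨i, j⟩ h
        simp only [Finset.mem_filter, Finset.mem_product, Finset.mem_range] at h ⊢
        omega
      · rintro ⟨k, l⟩ h
        simp only [Finset.mem_filter, Finset.mem_product, Finset.mem_range] at h ⊢
        omega
      · rintro ⟨i, j⟩ h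
        simp only [Finset.mem_filter, Finset.mem_product, Finset.mem_range, Prod.mk.injEq] at h ⊢
        omega
      · rintro ⟨k, l⟩ h
        simp only [Finset.mem_filter, Finset.mem_product, Finset.mem_range, Prod.mk.injEq] at h ⊢
        omega
      · rintro ⟨i, j⟩ h
        simp only [Finset.mem_filter, Finset.mem_product, Finset.mem_range] at h ⊢
        obtain ⟨k, rfl⟩ := Nat.exists_eq_add_of_le (by omega : i ≤ m)
        obtain ⟨l, rfl⟩ : ∃ l, j = d + k + l := ⟨j - d - k, by omega⟩
        obtain ⟨r, rfl⟩ : ∃ r, N = k + l + r := ⟨N - k - l, by omega⟩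
        have hk : i + k - i = k := by omega
        have hl : i + (d + k + l) - (i + k + d) = l := by omega
        have hs : i + (d + k + l) = i + k + d + l := by omega
        have hn : d + (k + l + r) = d + k + l + r := by omega
        have hc : ((i + k + d : ℕ) : ℝ) - (d + k + l + r : ℕ) - (i + k : ℕ) =
            -((k + l + r : ℕ) : ℝ) := by
          push_cast
          ring
        have hd₁ : ((i + k + d : ℕ) : ℝ) - (i + k : ℕ) = d := by
          push_cast
          ring
        have hd₂ : α + ((i + k + d : ℕ) : ℝ) - (i + k : ℕ) = α + d := by
          push_cast
          ring
        rw [hk, hl, hs, hn, hc, hd₁, hd₂]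
        exact lagCoeff_term_eq hα ha hb i d k l r
    · intro q _ hq
      by_contra! h
      exact hq (by rw [Nat.choose_eq_zero_of_lt h]; simp)
  · rintro ⟨k, l⟩ hq
    simp only [Finset.mem_filter, Finset.mem_product, Finset.mem_range] at hq
    have hc : ((m + d : ℕ) : ℝ) - (d + N : ℕ) - m = -(N : ℝ) := by push_cast; ring
    by_cases hk : m < k
    · simp [poch_neg_natCast_of_lt hk]
    · rw [hc, poch_neg_natCast_of_lt (by omega : N < k + l)]
      simp
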